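/- There is a constant C > 0, depending only on Q, such that for every natural number n the word w_n can be converted to the empty word by free reductions, free expansions, applications of relators of Q and cyclic conjugations, with every intermediate word of length at most C·n + C; that is, FFL(w_n) ≤ C·n + C. -/

import Mathlib

/-! Words over an alphabet `A`: a letter `(x, true)` is the generator `x`,
and `(x, false)` is its formal inverse `x⁻¹`. -/

/-- A word over the alphabet `A ∪ A⁻¹`. -/
abbrev Word (A : Type*) := List (A × Bool)

namespace Word

/-- The formal inverse of a word. -/
def inv {A : Type*} (w : Word A) : Word A := (w.map fun p => (p.1, !p.2)).reverse

/-- `w'` is a cyclic conjugate (cyclic permutation) of `w`. -/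
def IsCyclicConj {A : Type*} (w w' : Word A) : Prop :=
  ∃ u v : Word A, w = u ++ v ∧ w' = v ++ u

end Word

/-- Moves (i)–(iii) on words with respect to a set `R` of relator words:
free reduction, free expansion, and application of a relator (replace a subword `u`
by `v` where some cyclic conjugate of `u * v⁻¹` lies in `R ∪ R⁻¹`). -/
inductive Move {A : Type*} (R : Set (Word A)) : Word A → Word A → Prop
  | freeReduce (u v : Word A) (x : A) (b : Bool) :
      Move R (u ++ (x, b) :: (x, !b) :: v) (u ++ v)
  | freeExpand (u v : Word A) (x : A) (b : Bool) :
      Move R (u ++ v) (u ++ (x, b) :: (x, !b) :: v)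
  | relator (p q u v z : Word A)
      (hz : Word.IsCyclicConj (u ++ Word.inv v) z) (hR : z ∈ R ∨ Word.inv z ∈ R) :
      Move R (p ++ u ++ q) (p ++ v ++ q)

/-- Moves (i)–(iv): moves (i)–(iii) together with cyclic conjugation. -/
inductive MoveC {A : Type*} (R : Set (Word A)) : Word A → Word A → Prop
  | of {w w' : Word A} : Move R w w' → MoveC R w w'
  | cyc {w w' : Word A} : Word.IsCyclicConj w w' → MoveC R w w'

/-- Moves (i)–(v) on finite sequences of words: one of the moves (i)–(iv) applied to
one word of the sequence, or fragmentation of one word `u ++ v` into `u` and `v`. -/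
inductive MoveF {A : Type*} (R : Set (Word A)) : List (Word A) → List (Word A) → Prop
  | of (l₁ l₂ : List (Word A)) {w w' : Word A} :
      MoveC R w w' → MoveF R (l₁ ++ w :: l₂) (l₁ ++ w' :: l₂)
  | frag (l₁ l₂ : List (Word A)) (u v : Word A) :
      MoveF R (l₁ ++ (u ++ v) :: l₂) (l₁ ++ u :: v :: l₂)

/-- A word is null-homotopic over the presentation with relator set `R` if it represents
the identity of the presented group, i.e. lies in the normal closure of the relators. -/
def NullHomotopic {A : Type*} (R : Set (Word A)) (w : Word A) : Prop :=
  FreeGroup.mk w ∈ Subgroup.normalClosure (FreeGroup.mk '' R)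

/-- `FLle R w L`: the word `w` can be converted to the empty word by moves (i)–(iii)
with every intermediate word of length at most `L`. -/
def FLle {A : Type*} (R : Set (Word A)) (w : Word A) (L : ℕ) : Prop :=
  ∃ (m : ℕ) (f : ℕ → Word A), f 0 = w ∧ f m = [] ∧
    (∀ i < m, Move R (f i) (f (i + 1))) ∧ ∀ i ≤ m, (f i).length ≤ L

/-- `FFLle R w L`: the word `w` can be converted to the empty word by moves (i)–(iv)
with every intermediate word of length at most `L`. -/
def FFLle {A : Type*} (R : Set (Word A)) (w : Word A) (L : ℕ) : Prop :=
  ∃ (m : ℕ) (f : ℕ → Word A), f 0 = w ∧ f m = [] ∧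
    (∀ i < m, MoveC R (f i) (f (i + 1))) ∧ ∀ i ≤ m, (f i).length ≤ L

/-- The total length of a finite sequence of words. -/
def totalLength {A : Type*} (l : List (Word A)) : ℕ := (l.map List.length).sum

/-- `FFFLle R w L`: the length-one sequence `(w)` can be converted to a sequence of empty
words by moves (i)–(v) with every intermediate sequence of total length at most `L`. -/
def FFFLle {A : Type*} (R : Set (Word A)) (w : Word A) (L : ℕ) : Prop :=
  ∃ (m : ℕ) (f : ℕ → List (Word A)), f 0 = [w] ∧ (∀ u ∈ f m, u = ([] : Word A)) ∧
    (∀ i < m, MoveF R (f i) (f (i + 1))) ∧ ∀ i ≤ m, totalLength (f i) ≤ L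

/-- An element `x` of the free group is a conjugate of a relator of `R` or of an inverse
of a relator. -/
def IsConjRelator {A : Type*} (R : Set (Word A)) (x : FreeGroup A) : Prop :=
  ∃ c ρ : FreeGroup A, (ρ ∈ FreeGroup.mk '' R ∨ ρ⁻¹ ∈ FreeGroup.mk '' R) ∧ x = c * ρ * c⁻¹

/-- `AreaLe R g N`: in the free group, `g` is a product of at most `N` conjugates
of elements of `R ∪ R⁻¹`. -/
def AreaLe {A : Type*} (R : Set (Word A)) (g : FreeGroup A) (N : ℕ) : Prop :=
  ∃ l : List (FreeGroup A), l.length ≤ N ∧ (∀ x ∈ l, IsConjRelator R x) ∧ l.prod = g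

/-- The number of occurrences in `w` of the letter `x` or its inverse. -/
def countLtr {A : Type*} [DecidableEq A] (x : A) (w : Word A) : ℕ :=
  (w.filter fun p => p.1 = x).length

/-- The filling length `FL(w)` of a null-homotopic word. -/
noncomputable def FLw {A : Type*} (R : Set (Word A)) (w : Word A) : ℕ :=
  sInf {L | FLle R w L}

/-- The free filling length `FFL(w)` of a null-homotopic word. -/
noncomputable def FFLw {A : Type*} (R : Set (Word A)) (w : Word A) : ℕ :=
  sInf {L | FFLle R w L}

/-- The fragmenting free filling length `FFFL(w)` of a null-homotopic word. -/
noncomputable def FFFLw {A : Type*} (R : Set (Word A)) (w : Word A) : ℕ :=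
  sInf {L | FFFLle R w L}

/-- The filling length function `FL : ℕ → ℕ` of the presentation with relators `R`. -/
noncomputable def FLfn {A : Type*} (R : Set (Word A)) (n : ℕ) : ℕ :=
  sSup (FLw R '' {w | NullHomotopic R w ∧ w.length ≤ n})

/-- The free filling length function `FFL : ℕ → ℕ`. -/
noncomputable def FFLfn {A : Type*} (R : Set (Word A)) (n : ℕ) : ℕ :=
  sSup (FFLw R '' {w | NullHomotopic R w ∧ w.length ≤ n})

/-- The fragmenting free filling length function `FFFL : ℕ → ℕ`. -/
noncomputable def FFFLfn {A : Type*} (R : Set (Word A)) (n : ℕ) : ℕ :=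
  sSup (FFFLw R '' {w | NullHomotopic R w ∧ w.length ≤ n})

/-! The presentation `Q = ⟨a, b, r, s, t | a^b a⁻², [t,a], [r,at], [r,s], [s,t]⟩`. -/

/-- The five generators of the presentation `Q`. -/
inductive QGen | a | b | r | s | t
deriving DecidableEq

/-- The five relators of `Q`: `b⁻¹aba⁻¹a⁻¹`, `t⁻¹a⁻¹ta`, `r⁻¹t⁻¹a⁻¹rat`,
`r⁻¹s⁻¹rs`, `s⁻¹t⁻¹st`. -/
def QRels : Set (Word QGen) :=
  { [(QGen.b, false), (QGen.a, true), (QGen.b, true), (QGen.a, false), (QGen.a, false)],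
    [(QGen.t, false), (QGen.a, false), (QGen.t, true), (QGen.a, true)],
    [(QGen.r, false), (QGen.t, false), (QGen.a, false), (QGen.r, true), (QGen.a, true),
      (QGen.t, true)],
    [(QGen.r, false), (QGen.s, false), (QGen.r, true), (QGen.s, true)],
    [(QGen.s, false), (QGen.t, false), (QGen.s, true), (QGen.t, true)] }

/-- The word `bⁿ`. -/
def bpow (n : ℕ) : Word QGen := List.replicate n (QGen.b, true)

/-- The word `b⁻ⁿ`. -/
def bpowInv (n : ℕ) : Word QGen := List.replicate n (QGen.b, false)

/-- The word `a^{-bⁿ} = b⁻ⁿ a⁻¹ bⁿ`. -/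
def aConjNeg (n : ℕ) : Word QGen := bpowInv n ++ [(QGen.a, false)] ++ bpow n

/-- The word `a^{bⁿ} = b⁻ⁿ a bⁿ`. -/
def aConjPos (n : ℕ) : Word QGen := bpowInv n ++ [(QGen.a, true)] ++ bpow n

/-- The word `a^{-bⁿ} r a^{bⁿ}`. -/
def gword (n : ℕ) : Word QGen := aConjNeg n ++ [(QGen.r, true)] ++ aConjPos n

/-- The word `w_n = [s, a^{-bⁿ} r a^{bⁿ}] = s⁻¹ (b⁻ⁿa⁻¹bⁿ r b⁻ⁿabⁿ)⁻¹ s (b⁻ⁿa⁻¹bⁿ r b⁻ⁿabⁿ)`. -/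
def wn (n : ℕ) : Word QGen :=
  [(QGen.s, false)] ++ Word.inv (gword n) ++ [(QGen.s, true)] ++ gword n

/-- The word `a^{-bⁿ} r a^{bⁿ} r a^{bⁿ} r⁻¹ a^{-bⁿ}`. -/
def g'word (n : ℕ) : Word QGen :=
  aConjNeg n ++ [(QGen.r, true)] ++ aConjPos n ++ [(QGen.r, true)] ++ aConjPos n ++
    [(QGen.r, false)] ++ aConjNeg n

/-- The word `w'_n = [s, a^{-bⁿ} r a^{bⁿ} r a^{bⁿ} r⁻¹ a^{-bⁿ}]`. -/
def w'n (n : ℕ) : Word QGen :=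
  [(QGen.s, false)] ++ Word.inv (g'word n) ++ [(QGen.s, true)] ++ g'word n

namespace Word

variable {A : Type*}

@[simp] theorem inv_nil : inv ([] : Word A) = [] := rfl

@[simp] theorem inv_append (u v : Word A) : inv (u ++ v) = inv v ++ inv u := by
  simp [inv]

@[simp] theorem inv_cons (p : A × Bool) (v : Word A) : inv (p :: v) = inv v ++ [(p.1, !p.2)] := by
  simp [inv]

@[simp] theorem inv_inv (u : Word A) : inv (inv u) = u := by
  induction u with
  | nil => rfl
  | cons p u ih => simp [ih]

@[simp] theorem length_inv (u : Word A) : (inv u).length = u.length := by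
  simp [inv]

end Word

theorem Move.symm {A : Type*} {R : Set (Word A)} {w w' : Word A} (h : Move R w w') :
    Move R w' w := by
  cases h with
  | freeReduce u v x b => exact .freeExpand u v x b
  | freeExpand u v x b => exact .freeReduce u v x b
  | relator p q u v z hz hR =>
    obtain ⟨x, y, hxy, rfl⟩ := hz
    refine .relator p q v u (Word.inv (y ++ x)) ⟨Word.inv y, Word.inv x, ?_, ?_⟩ ?_
    · simpa using congrArg Word.inv hxy
    · simp
    · rw [Word.inv_inv]
      exact hR.symm

theorem Move.append_context {A : Type*} {R : Set (Word A)} {w w' : Word A} (h : Move R w w')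
    (p q : Word A) : Move R (p ++ w ++ q) (p ++ w' ++ q) := by
  cases h with
  | freeReduce u v x b => simpa using Move.freeReduce (R := R) (p ++ u) (v ++ q) x b
  | freeExpand u v x b => simpa using Move.freeExpand (R := R) (p ++ u) (v ++ q) x b
  | relator p' q' u v z hz hR =>
    simpa using Move.relator (R := R) (p ++ p') (q' ++ q) u v z hz hR

/-- `w` can be converted to `w'` by moves (i)–(iii) through words of length at most `L`. -/
def Reach {A : Type*} (R : Set (Word A)) (L : ℕ) : Word A → Word A → Prop :=
  Relation.ReflTransGen fun w w' => Move R w w' ∧ w.length ≤ L ∧ w'.length ≤ L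

/-- `w` can be converted to `w'` by moves (i)–(iv) through words of length at most `L`. -/
def ReachC {A : Type*} (R : Set (Word A)) (L : ℕ) : Word A → Word A → Prop :=
  Relation.ReflTransGen fun w w' => MoveC R w w' ∧ w.length ≤ L ∧ w'.length ≤ L

namespace Reach

variable {A : Type*} {R : Set (Word A)} {L : ℕ} {w w' : Word A}

theorem symm (h : Reach R L w w') : Reach R L w' w :=
  by
  induction h with
  | refl => exact .refl
  | tail _ h ih => exact .head ⟨h.1.symm, h.2.2, h.2.1⟩ ih

theorem toReachC (h : Reach R L w w') : ReachC R L w w' :=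
  Relation.ReflTransGen.lift id (fun _ _ h => ⟨.of h.1, h.2⟩) _ _ h

theorem append_context (h : Reach R L w w') (p q : Word A) {L' : ℕ}
    (hL : p.length + L + q.length ≤ L') : Reach R L' (p ++ w ++ q) (p ++ w' ++ q) := by
  refine Relation.ReflTransGen.lift (fun w => p ++ w ++ q) (fun x y h => ?_) _ _ h
  refine ⟨h.1.append_context p q, ?_, ?_⟩ <;> simp only [List.length_append] <;> omega

theorem mono (h : Reach R L w w') {L' : ℕ} (hL : L ≤ L') : Reach R L' w w' := by
  simpa using h.append_context [] [] (L' := L') (by simpa using hL)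

/-- Application of a relator, inside a context `p`, `q`. -/
theorem relator {u v : Word A} (p q x y : Word A) (huv : u ++ Word.inv v = x ++ y)
    (hR : y ++ x ∈ R ∨ Word.inv (y ++ x) ∈ R) (hu : p.length + u.length + q.length ≤ L)
    (hv : p.length + v.length + q.length ≤ L) : Reach R L (p ++ u ++ q) (p ++ v ++ q) :=
  .single ⟨.relator p q u v _ ⟨x, y, huv, rfl⟩ hR, by simpa [add_assoc] using hu,
    by simpa [add_assoc] using hv⟩

theorem inv_append_cancel (u : Word A) (hL : 2 * u.length ≤ L) :
    Reach R L (Word.inv u ++ u) [] := by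
  induction u generalizing L with
  | nil => exact .refl
  | cons p u ih =>
    simp only [List.length_cons] at hL
    refine .head ⟨?_, ?_, ?_⟩ (ih (L := L) (by omega))
    · simpa using Move.freeReduce (R := R) (Word.inv u) u p.1 (!p.2)
    · simp; omega
    · simp; omega

theorem append_inv_cancel (u : Word A) (hL : 2 * u.length ≤ L) :
    Reach R L (u ++ Word.inv u) [] := by
  simpa using inv_append_cancel (R := R) (L := L) (Word.inv u) (by simpa using hL)

/-- A conversion `w ⇝ w'` yields a conversion `w⁻¹ ⇝ w'⁻¹`. -/
theorem inv (h : Reach R L w w') {L' : ℕ} (hw : w.length + L + w'.length ≤ L')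
    (hw₁ : w.length + 2 * w'.length ≤ L') (hw₂ : 2 * w.length + w'.length ≤ L') :
    Reach R L' (Word.inv w) (Word.inv w') := by
  have h₁ := (append_inv_cancel (R := R) w' le_rfl).symm.append_context (Word.inv w) []
    (L' := L') (by simpa using hw₁)
  have h₂ := h.symm.append_context (Word.inv w) (Word.inv w') (L' := L') (by simpa using hw)
  have h₃ := (inv_append_cancel (R := R) w le_rfl).append_context [] (Word.inv w')
    (L' := L') (by simpa using hw₂)
  simp only [List.append_nil, List.nil_append, List.append_assoc] at h₁ h₂ h₃
  exact h₁.trans (h₂.trans h₃)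

/-- If `u⁻¹xu ⇝ x` then `u⁻¹x ⇝ xu⁻¹`. -/
theorem inv_append_comm {u x : Word A} (h : Reach R L (Word.inv u ++ x ++ u) x) {L' : ℕ}
    (hL : L + u.length ≤ L') (hu : 3 * u.length + x.length ≤ L') :
    Reach R L' (Word.inv u ++ x) (x ++ Word.inv u) := by
  have h₁ := (append_inv_cancel (R := R) u le_rfl).symm.append_context (Word.inv u ++ x) []
    (L' := L') (by simp; omega)
  have h₂ := h.append_context [] (Word.inv u) (L' := L') (by simpa using hL)
  simp only [List.append_nil, List.nil_append, List.append_assoc] at h₁ h₂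
  exact h₁.trans h₂

/-- If `u⁻¹xu ⇝ x` then `xu ⇝ ux`. -/
theorem append_comm {u x : Word A} (h : Reach R L (Word.inv u ++ x ++ u) x) {L' : ℕ}
    (hL : L + u.length ≤ L') (hu : 3 * u.length + x.length ≤ L') :
    Reach R L' (x ++ u) (u ++ x) := by
  have h₁ := (append_inv_cancel (R := R) u le_rfl).symm.append_context [] (x ++ u)
    (L' := L') (by simp; omega)
  have h₂ := h.append_context u [] (L' := L') (by simp; omega)
  simp only [List.append_nil, List.nil_append, List.append_assoc] at h₁ h₂
  exact h₁.trans h₂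

end Reach

theorem ReachC.mono {A : Type*} {R : Set (Word A)} {L L' : ℕ} {w w' : Word A}
    (h : ReachC R L w w') (hL : L ≤ L') : ReachC R L' w w' :=
  Relation.ReflTransGen.lift id (fun _ _ h => ⟨h.1, h.2.1.trans hL, h.2.2.trans hL⟩) _ _ h

theorem ReachC.FFLle {A : Type*} {R : Set (Word A)} {L : ℕ} {w : Word A} (h : ReachC R L w [])
    (hw : w.length ≤ L) : FFLle R w L := by
  induction h using Relation.ReflTransGen.head_induction_on with
  | refl => exact ⟨0, fun _ => [], rfl, rfl, by simp, by simp⟩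
  | @head x _ h _ ih =>
    obtain ⟨m, f, h₀, hm, hmove, hlen⟩ := ih h.2.2
    refine ⟨m + 1, fun i => Nat.casesOn i x f, rfl, hm, fun i hi => ?_, fun i hi => ?_⟩
    · cases i with
      | zero => simpa [h₀] using h.1
      | succ i => exact hmove i (by omega)
    · cases i with
      | zero => exact hw
      | succ i => exact hlen i (by omega)

open QGen

/-- A word of length at most `3 * d + k / 2 ^ d` representing `a ^ k`: the lowest `d` binary
digits of `k` are spread over `d` nested conjugations by `b`. -/
def aPow : ℕ → ℕ → Word QGen
  | 0, k => List.replicate k (a, true)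
  | d + 1, k => List.replicate (k % 2) (a, true) ++ (b, false) :: (aPow d (k / 2) ++ [(b, true)])

theorem length_aPow_le (d k : ℕ) : (aPow d k).length ≤ 3 * d + k / 2 ^ d := by
  induction d generalizing k with
  | zero => simp [aPow]
  | succ d ih =>
    have h := ih (k / 2)
    rw [Nat.div_div_eq_div_mul, ← pow_succ'] at h
    simp [aPow]
    omega

theorem length_aPow_le_of_le {n k : ℕ} (hk : k ≤ 2 ^ n) : (aPow n k).length ≤ 3 * n + 1 :=
  (length_aPow_le n k).trans (by gcongr; exact Nat.div_le_of_le_mul (by simpa using hk))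

theorem aPow_two_pow (n : ℕ) : aPow n (2 ^ n) = aConjPos n := by
  induction n with
  | zero => rfl
  | succ n ih =>
    have h : 2 ^ (n + 1) / 2 = 2 ^ n := by omega
    have h' : 2 ^ (n + 1) % 2 = 0 := by omega
    simp only [aPow, h, h', ih, aConjPos, bpowInv, bpow]
    rw [List.replicate_succ (n := n) (a := (b, false)), List.replicate_succ' (n := n)]
    simp

theorem reach_cons_aPow (d k : ℕ) :
    Reach QRels (3 * d + k / 2 ^ d + 2) ((a, true) :: aPow d k) (aPow d (k + 1)) := by
  induction d generalizing k with
  | zero => exact .refl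
  | succ d ih =>
    have hlen := length_aPow_le d (k / 2)
    have h := ih (k / 2)
    rw [Nat.div_div_eq_div_mul, ← pow_succ'] at hlen h
    obtain hk | hk := Nat.mod_two_eq_zero_or_one k
    · have h₁ : (k + 1) % 2 = 1 := by omega
      have h₂ : (k + 1) / 2 = k / 2 := by omega
      simp only [aPow, hk, h₁, h₂]
      exact .refl
    · have h₁ : (k + 1) % 2 = 0 := by omega
      have h₂ : (k + 1) / 2 = k / 2 + 1 := by omega
      simp only [aPow, hk, h₁, h₂]
      have h₃ : Reach QRels (3 * (d + 1) + k / 2 ^ (d + 1) + 2)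
          ([] ++ [(a, true), (a, true), (b, false)] ++ (aPow d (k / 2) ++ [(b, true)]))
          ([] ++ [(b, false), (a, true)] ++ (aPow d (k / 2) ++ [(b, true)])) :=
        .relator _ _ _ [] (List.append_nil _).symm (by simp [QRels]) (by simp; omega)
          (by simp; omega)
      have h₄ := h.append_context [(b, false)] [(b, true)]
        (L' := 3 * (d + 1) + k / 2 ^ (d + 1) + 2) (by simp; omega)
      simp only [List.nil_append, List.cons_append] at h₃ h₄
      exact h₃.trans h₄

theorem reach_aPow_succ {n k : ℕ} (hk : k < 2 ^ n) :
    Reach QRels (3 * n + 2) (aPow n (k + 1)) ((a, true) :: aPow n k) := by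
  have h := (reach_cons_aPow n k).symm
  rwa [Nat.div_eq_of_lt hk, add_zero] at h

theorem reach_inv_aPow_succ {n k : ℕ} (hk : k < 2 ^ n) :
    Reach QRels (9 * n + 5) (Word.inv (aPow n (k + 1))) (Word.inv (aPow n k) ++ [(a, false)]) := by
  have h₁ : (aPow n (k + 1)).length ≤ 3 * n + 1 := length_aPow_le_of_le hk
  have h₂ := length_aPow_le n k
  rw [Nat.div_eq_of_lt hk] at h₂
  simpa using (reach_aPow_succ hk).inv (L' := 9 * n + 5) (by simp; omega) (by simp; omega)
    (by simp; omega)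

theorem reach_conj_aPow_succ {n k : ℕ} (hk : k < 2 ^ n) (x : Word QGen) :
    Reach QRels (12 * n + 6 + x.length) (Word.inv (aPow n (k + 1)) ++ x ++ aPow n (k + 1))
      (Word.inv (aPow n k) ++ ([(a, false)] ++ x ++ [(a, true)]) ++ aPow n k) := by
  have h₁ : (aPow n (k + 1)).length ≤ 3 * n + 1 := length_aPow_le_of_le hk
  have h₂ := length_aPow_le n k
  rw [Nat.div_eq_of_lt hk] at h₂
  have h₃ := (reach_inv_aPow_succ hk).append_context [] (x ++ aPow n (k + 1))
    (L' := 12 * n + 6 + x.length) (by simp; omega)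
  have h₄ := (reach_aPow_succ hk).append_context (Word.inv (aPow n k) ++ [(a, false)] ++ x) []
    (L' := 12 * n + 6 + x.length) (by simp; omega)
  simp only [List.append_nil, List.nil_append, List.append_assoc, List.cons_append] at h₃ h₄ ⊢
  exact h₃.trans h₄

theorem aPow_zero (n : ℕ) : aPow n 0 = bpowInv n ++ Word.inv (bpowInv n) := by
  induction n with
  | zero => rfl
  | succ n ih =>
    simp only [aPow, Nat.zero_mod, Nat.zero_div, ih, bpowInv]
    simp [List.replicate_succ]

theorem reach_conj_aPow_zero (n : ℕ) (x : Word QGen) :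
    Reach QRels (12 * n + 6 + x.length) (Word.inv (aPow n 0) ++ x ++ aPow n 0) x := by
  have h := Reach.append_inv_cancel (R := QRels) (bpowInv n) le_rfl
  rw [← aPow_zero] at h
  have hl : (aPow n 0).length ≤ 3 * n := by simpa using length_aPow_le n 0
  have hb : (bpowInv n).length = n := by simp [bpowInv]
  have hi := h.inv (L' := 6 * n) (by simp; omega) (by simp; omega) (by simp; omega)
  have h₁ := hi.append_context [] (x ++ aPow n 0) (L' := 12 * n + 6 + x.length) (by simp; omega)
  have h₂ := h.append_context x [] (L' := 12 * n + 6 + x.length) (by simp; omega)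
  simp only [List.append_nil, List.nil_append, List.append_assoc, Word.inv_nil] at h₁ h₂ ⊢
  exact h₁.trans h₂

/-- The letter `t^{±1}` commutes with the compressed powers of `a`. -/
theorem reach_conj_t {n k : ℕ} (hk : k ≤ 2 ^ n) (e : Bool) :
    Reach QRels (12 * n + 7) (Word.inv (aPow n k) ++ [(t, e)] ++ aPow n k) [(t, e)] := by
  induction k with
  | zero => exact (reach_conj_aPow_zero n [(t, e)]).mono (by simp)
  | succ k ih =>
    have hl := length_aPow_le n k
    rw [Nat.div_eq_of_lt hk] at hl
    refine (reach_conj_aPow_succ hk [(t, e)]).trans (.trans ?_ (ih (by omega)))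
    cases e
    · exact Reach.relator _ _ [] [(a, false), (t, false), (a, true), (t, true)] rfl
        (by simp [QRels]) (by simp; omega) (by simp; omega)
    · exact Reach.relator _ _ [(a, false), (t, true), (a, true)] [(t, false)] rfl
        (by simp [QRels]) (by simp; omega) (by simp; omega)

/-- The conjugate of `r^{±1}` by the compressed word for `a ^ k`. -/
def rConj (n k : ℕ) (e : Bool) : Word QGen := Word.inv (aPow n k) ++ [(r, e)] ++ aPow n k

theorem length_rConj_le {n k : ℕ} (hk : k ≤ 2 ^ n) (e : Bool) :
    (rConj n k e).length ≤ 6 * n + 3 := by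
  have h := length_aPow_le_of_le hk
  simp [rConj]
  omega

theorem reach_rConj_succ {n k : ℕ} (hk : k < 2 ^ n) (e : Bool) :
    Reach QRels (18 * n + 12) (rConj n (k + 1) e)
      ([(t, true)] ++ rConj n k e ++ [(t, false)]) := by
  have hl := length_aPow_le n k
  rw [Nat.div_eq_of_lt hk] at hl
  have h₁ : Reach QRels (18 * n + 12) (rConj n (k + 1) e)
      (Word.inv (aPow n k) ++ ([(a, false)] ++ [(r, e)] ++ [(a, true)]) ++ aPow n k) :=
    (reach_conj_aPow_succ hk [(r, e)]).mono (by simp; omega)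
  have h₂ : Reach QRels (18 * n + 12)
      (Word.inv (aPow n k) ++ ([(a, false)] ++ [(r, e)] ++ [(a, true)]) ++ aPow n k)
      (Word.inv (aPow n k) ++ [(t, true), (r, e), (t, false)] ++ aPow n k) := by
    cases e
    · exact .relator _ _ [(a, false), (r, false), (a, true), (t, true), (r, true)] [(t, false)]
        rfl (by simp [QRels]) (by simp; omega) (by simp; omega)
    · exact .relator _ _ [(a, false), (r, true), (a, true), (t, true)] [(r, false), (t, false)]
        rfl (by simp [QRels]) (by simp; omega) (by simp; omega)
  have h₃ := ((reach_conj_t hk.le true).inv_append_comm (L' := 15 * n + 7) (by omega)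
    (by simp; omega)).append_context [] ([(r, e), (t, false)] ++ aPow n k)
    (L' := 18 * n + 12) (by simp; omega)
  have h₄ := ((reach_conj_t hk.le false).append_comm (L' := 15 * n + 7) (by omega)
    (by simp; omega)).append_context ([(t, true)] ++ Word.inv (aPow n k) ++ [(r, e)]) []
    (L' := 18 * n + 12) (by simp; omega)
  simp only [rConj, List.append_nil, List.nil_append, List.append_assoc, List.cons_append]
    at h₁ h₂ h₃ h₄ ⊢
  exact h₁.trans (h₂.trans (h₃.trans h₄))

/-- The commutator of `s` with the conjugate of `r` by the compressed word for `a ^ k`. -/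
def sComm (n k : ℕ) : Word QGen :=
  [(s, false)] ++ rConj n k false ++ [(s, true)] ++ rConj n k true

theorem sComm_two_pow (n : ℕ) : sComm n (2 ^ n) = wn n := by
  simp [sComm, rConj, aPow_two_pow, wn, gword, aConjPos, aConjNeg, bpow, bpowInv, Word.inv]

theorem reachC_sComm_succ {n k : ℕ} (hk : k < 2 ^ n) :
    ReachC QRels (24 * n + 20) (sComm n (k + 1)) (sComm n k) := by
  have hl : ∀ e, (rConj n k e).length ≤ 6 * n + 3 := length_rConj_le hk.le
  have hl' : ∀ e, (rConj n (k + 1) e).length ≤ 6 * n + 3 := length_rConj_le hk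
  have hf := hl false
  have ht := hl true
  have ht' := hl' true
  have h₁ := (reach_rConj_succ hk false).append_context [(s, false)]
    ([(s, true)] ++ rConj n (k + 1) true) (L' := 24 * n + 20) (by simp; omega)
  have h₂ := (reach_rConj_succ hk true).append_context
    ([(s, false), (t, true)] ++ rConj n k false ++ [(t, false), (s, true)]) []
    (L' := 24 * n + 20) (by simp; omega)
  have h₃ : Reach QRels (24 * n + 20)
      (([(s, false), (t, true)] ++ rConj n k false) ++ [(t, false), (s, true), (t, true)] ++
        (rConj n k true ++ [(t, false)]))
      (([(s, false), (t, true)] ++ rConj n k false) ++ [(s, true)] ++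
        (rConj n k true ++ [(t, false)])) :=
    .relator _ _ [(t, false), (s, true), (t, true)] [(s, false)] rfl (by simp [QRels])
      (by simp; omega) (by simp; omega)
  have h₄ : ReachC QRels (24 * n + 20)
      (([(s, false), (t, true)] ++ rConj n k false ++ [(s, true)] ++ rConj n k true) ++
        [(t, false)])
      ([(t, false)] ++
        ([(s, false), (t, true)] ++ rConj n k false ++ [(s, true)] ++ rConj n k true)) :=
    .single ⟨.cyc ⟨_, _, rfl, rfl⟩, by simp; omega, by simp; omega⟩
  have h₅ : Reach QRels (24 * n + 20)
      ([] ++ [(t, false), (s, false), (t, true)] ++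
        (rConj n k false ++ [(s, true)] ++ rConj n k true))
      ([] ++ [(s, false)] ++ (rConj n k false ++ [(s, true)] ++ rConj n k true)) :=
    .relator _ _ [] [(t, false), (s, false), (t, true), (s, true)] rfl (by simp [QRels])
      (by simp; omega) (by simp; omega)
  replace h₁ := h₁.toReachC
  replace h₂ := h₂.toReachC
  replace h₃ := h₃.toReachC
  replace h₅ := h₅.toReachC
  simp only [sComm, List.append_nil, List.nil_append, List.append_assoc, List.cons_append]
    at h₁ h₂ h₃ h₄ h₅ ⊢
  exact h₁.trans (h₂.trans (h₃.trans (h₄.trans h₅)))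

theorem reachC_sComm_zero (n : ℕ) : ReachC QRels (24 * n + 20) (sComm n 0) [] := by
  have hl := length_rConj_le (Nat.zero_le (2 ^ n)) true
  have h₁ := (reach_conj_aPow_zero n [(r, false)]).append_context [(s, false)]
    ([(s, true)] ++ rConj n 0 true) (L' := 24 * n + 20) (by simp; omega)
  have h₂ := (reach_conj_aPow_zero n [(r, true)]).append_context
    [(s, false), (r, false), (s, true)] [] (L' := 24 * n + 20) (by simp; omega)
  have h₃ : Reach QRels (24 * n + 20)
      ([] ++ [(s, false), (r, false), (s, true), (r, true)] ++ []) ([] ++ [] ++ []) :=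
    .relator _ _ [] [(s, false), (r, false), (s, true), (r, true)] rfl (by simp [QRels, Word.inv])
      (by simp) (by simp)
  simp only [sComm, rConj, List.append_nil, List.nil_append, List.append_assoc, List.cons_append]
    at h₁ h₂ h₃ ⊢
  exact Reach.toReachC (h₁.trans (h₂.trans h₃))

theorem reachC_sComm_nil {n k : ℕ} (hk : k ≤ 2 ^ n) :
    ReachC QRels (24 * n + 20) (sComm n k) [] := by
  induction k with
  | zero => exact reachC_sComm_zero n
  | succ k ih => exact (reachC_sComm_succ hk).trans (ih (by omega))

theorem FFL_wn_upper_bound :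
    ∃ C : ℕ, 0 < C ∧ ∀ n : ℕ, FFLle QRels (wn n) (C * n + C) := by
  refine ⟨24, by norm_num, fun n => ?_⟩
  rw [← sComm_two_pow]
  refine ReachC.FFLle ((reachC_sComm_nil le_rfl).mono (by omega)) ?_
  have hf := length_rConj_le (le_refl (2 ^ n)) false
  have ht := length_rConj_le (le_refl (2 ^ n)) true
  simp [sComm]
  omega
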